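/- arXiv:1812.04961 — 3 statements merged into one kernel-verified Lean document; each statement's English description precedes it below -/
import Mathlib

section
/- Let X and Y be finite types, let V = X ⊕ Y, and let E : V → V → Prop be an edge relation. Suppose that every state node can reach some output node: for every x ∈ X there exists y ∈ Y with Relation.ReflTransGen E (Sum.inl x) (Sum.inr y). Then there exists a successor function s : X → V such that (i) for every x ∈ X, E (Sum.inl x) (s x) holds (each state node keeps exactly one outgoing edge of the original graph), and (ii) for every x ∈ X there exists k ∈ ℕ such that iterating the map q : V → V defined by q (Sum.inl x) = s x and q (Sum.inr y) = Sum.inr y, k times starting from Sum.inl x, lands in the image of Sum.inr (repeatedly following successors from any state node reaches an output node in finitely many steps). In other words, the graph contains a spanning subgraph that is a disjoint union of directed trees topped at output nodes in which every state node has exactly one outgoing edge. -/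
/-- There is a walk along `r` with exactly `n` steps from the given vertex into `T`. -/
def HasWalkInto {V : Type*} (r : V → V → Prop) (T : Set V) : ℕ → V → Prop
  | 0, v => v ∈ T
  | n + 1, v => ∃ w, r v w ∧ HasWalkInto r T n w

theorem exists_hasWalkInto_of_reflTransGen {V : Type*} {r : V → V → Prop} {T : Set V} {v t : V}
    (h : Relation.ReflTransGen r v t) (ht : t ∈ T) : ∃ n, HasWalkInto r T n v := by
  induction h using Relation.ReflTransGen.head_induction_on with
  | refl => exact ⟨0, ht⟩
  | head hvw _ ih =>
    obtain ⟨n, hn⟩ := ih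
    exact ⟨n + 1, _, hvw, hn⟩

/-- If `T` is reachable from every vertex, then the distance to `T` is a rank function that
drops along some edge at every vertex outside `T`. -/
theorem exists_rank_of_reachable {V : Type*} {r : V → V → Prop} {T : Set V}
    (h : ∀ v, ∃ t ∈ T, Relation.ReflTransGen r v t) :
    ∃ d : V → ℕ, ∀ v ∉ T, ∃ w, r v w ∧ d w < d v := by
  classical
  have hex (v : V) : ∃ n, HasWalkInto r T n v := by
    obtain ⟨t, ht, hvt⟩ := h v
    exact exists_hasWalkInto_of_reflTransGen hvt ht
  refine ⟨fun v => Nat.find (hex v), fun v hv => ?_⟩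
  beta_reduce
  have hspec := Nat.find_spec (hex v)
  generalize Nat.find (hex v) = n at hspec ⊢
  cases n with
  | zero => exact absurd hspec hv
  | succ n =>
    obtain ⟨w, hvw, hw⟩ := hspec
    exact ⟨w, hvw, Nat.lt_succ_of_le (Nat.find_min' (hex w) hw)⟩

/-- Iterating a map that lowers a rank outside `T` eventually enters `T`. -/
theorem exists_iterate_mem_of_rank_lt {V : Type*} {T : Set V} {q : V → V} {d : V → ℕ}
    (h : ∀ v ∉ T, d (q v) < d v) (v : V) : ∃ k, q^[k] v ∈ T := by
  induction hn : d v using Nat.strong_induction_on generalizing v with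
  | _ n ih =>
    by_cases hv : v ∈ T
    · exact ⟨0, hv⟩
    · obtain ⟨k, hk⟩ := ih _ (hn ▸ h v hv) (q v) rfl
      exact ⟨k + 1, hk⟩

/-- If every state node (in `X`) can reach some output node (in `Y`),
then the graph has a spanning subgraph that is a disjoint union of directed
trees topped at output nodes, in which every state node has exactly one
outgoing edge: a successor function `s` picking one outgoing edge per state
node such that repeatedly following successors reaches an output node. -/
theorem spanning_output_topped_trees
    {X Y : Type*} [Finite X] [Finite Y]
    (E : (X ⊕ Y) → (X ⊕ Y) → Prop)
    (h : ∀ x : X, ∃ y : Y, Relation.ReflTransGen E (Sum.inl x) (Sum.inr y)) :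
    ∃ s : X → (X ⊕ Y),
      (∀ x : X, E (Sum.inl x) (s x)) ∧
      (∀ x : X, ∃ k : ℕ,
        (Sum.elim s (fun y : Y => Sum.inr y))^[k] (Sum.inl x)
          ∈ Set.range (Sum.inr : Y → X ⊕ Y)) := by
  have hreach : ∀ v, ∃ t ∈ Set.range (Sum.inr : Y → X ⊕ Y), Relation.ReflTransGen E v t := by
    rintro (x | y)
    · obtain ⟨y, hy⟩ := h x
      exact ⟨_, ⟨y, rfl⟩, hy⟩
    · exact ⟨_, ⟨y, rfl⟩, .refl⟩
  obtain ⟨d, hd⟩ := exists_rank_of_reachable hreach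
  choose s hs hlt using fun x : X => hd (Sum.inl x) (by simp)
  refine ⟨s, hs, fun x => exists_iterate_mem_of_rank_lt (d := d) ?_ _⟩
  rintro (x | y) hv
  · exact hlt x
  · exact absurd ⟨y, rfl⟩ hv
end

section
/- Let V be a finite type and E : V → V → Prop an edge relation, with reachability reach = Relation.ReflTransGen E. Call a vertex v a top vertex if for all w, reach v w implies reach w v, and let SCC(v) = {w | reach v w ∧ reach w v}. Then the minimum cardinality of a set S ⊆ V such that every vertex of V can reach some element of S equals the number of top strongly connected components of the graph, i.e. the cardinality of the finite set of sets {SCC(v) | v is a top vertex}. -/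
open Relation

/-- The class of a vertex under mutual reachability. -/
def stronglyConnectedClass {V : Type*} (E : V → V → Prop) (v : V) : Set V :=
  {w | ReflTransGen E v w ∧ ReflTransGen E w v}

theorem stronglyConnectedClass_eq {V : Type*} {E : V → V → Prop} {v w : V}
    (hvw : ReflTransGen E v w) (hwv : ReflTransGen E w v) :
    stronglyConnectedClass E v = stronglyConnectedClass E w := by
  ext u
  exact ⟨fun h => ⟨hwv.trans h.1, h.2.trans hvw⟩, fun h => ⟨hvw.trans h.1, h.2.trans hwv⟩⟩

/-- In a finite digraph every vertex reaches a top vertex. -/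
theorem exists_reachable_top {V : Type*} [Finite V] (E : V → V → Prop) (v : V) :
    ∃ t, ReflTransGen E v t ∧ ∀ w, ReflTransGen E t w → ReflTransGen E w t := by
  obtain ⟨t, hvt, hmin⟩ := Set.exists_min_image {t | ReflTransGen E v t}
    (fun t => {w | ReflTransGen E t w}.ncard) (Set.toFinite _) ⟨v, .refl⟩
  refine ⟨t, hvt, fun w htw => ?_⟩
  have hsub : {u | ReflTransGen E w u} ⊆ {u | ReflTransGen E t u} := fun _ hu => htw.trans hu
  have heq := Set.eq_of_subset_of_ncard_le hsub (hmin w (ReflTransGen.trans hvt htw))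
  exact heq.ge (show ReflTransGen E t t from .refl)

/-- The minimal number of sensor nodes (a minimum-cardinality set `S` that
every vertex can reach) equals the number of top strongly connected
components of the finite digraph. -/
theorem min_sensor_nodes_eq_card_top_SCCs
    {V : Type*} [Finite V] (E : V → V → Prop) :
    sInf {n : ℕ | ∃ S : Set V, S.ncard = n ∧
        ∀ v : V, ∃ s ∈ S, Relation.ReflTransGen E v s}
    = Set.ncard {C : Set V | ∃ v : V,
        (∀ w : V, Relation.ReflTransGen E v w → Relation.ReflTransGen E w v) ∧
        C = {w : V | Relation.ReflTransGen E v w ∧ Relation.ReflTransGen E w v}} := by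
  set T := {C : Set V | ∃ v : V,
    (∀ w : V, ReflTransGen E v w → ReflTransGen E w v) ∧ C = stronglyConnectedClass E v}
  suffices h : IsLeast {n : ℕ | ∃ S : Set V, S.ncard = n ∧
      ∀ v : V, ∃ s ∈ S, ReflTransGen E v s} T.ncard from h.csInf_eq
  constructor
  · have hne : ∀ C : T, ∃ v, v ∈ C.1 := by
      rintro ⟨_, v, -, rfl⟩
      exact ⟨v, .refl, .refl⟩
    choose f hf using hne
    have hinj : Function.Injective f := by
      rintro ⟨C, v, hv, rfl⟩ ⟨D, w, hw, rfl⟩ h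
      have hv' := hf ⟨_, v, hv, rfl⟩
      have hw' := hf ⟨_, w, hw, rfl⟩
      rw [← h] at hw'
      exact Subtype.ext (stronglyConnectedClass_eq (hv'.1.trans hw'.2) (hw'.1.trans hv'.2))
    refine ⟨Set.range f, ?_, fun v => ?_⟩
    · rw [← Set.image_univ, Set.ncard_image_of_injective _ hinj, Set.ncard_univ,
        Nat.card_coe_set_eq]
    · obtain ⟨t, hvt, ht⟩ := exists_reachable_top E v
      exact ⟨_, ⟨⟨_, t, ht, rfl⟩, rfl⟩, hvt.trans (hf ⟨_, t, ht, rfl⟩).1⟩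
  · rintro _ ⟨S, rfl, hS⟩
    have hsub : T ⊆ stronglyConnectedClass E '' S := by
      rintro _ ⟨v, hv, rfl⟩
      obtain ⟨s, hs, hvs⟩ := hS v
      exact ⟨s, hs, stronglyConnectedClass_eq (hv s hvs) hvs⟩
    exact (Set.ncard_le_ncard hsub).trans (Set.ncard_image_le)
end

section
/- Let V be a finite type and E : V → V → Prop an edge relation, with reachability reach = Relation.ReflTransGen E; call a vertex v a root vertex if for all w, reach w v implies reach v w, and let SCC(v) = {w | reach v w ∧ reach w v}. Let R ⊆ V be any set that intersects SCC(v) for every root vertex v. Define the extended digraph on Option V whose edge relation E' satisfies: E' (some a) (some b) ↔ E a b, E' none (some v) ↔ v ∈ R, and none has no incoming edges. Then in this extended digraph every vertex some v (v ∈ V) is reachable from the single new input vertex none. Consequently, a single input node suffices to render any finite directed graph structurally accessible. -/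
/-- In a finite directed graph every vertex is reachable from a root vertex. -/
theorem exists_root_reflTransGen {V : Type*} [Finite V] (E : V → V → Prop) (v : V) :
    ∃ u : V, Relation.ReflTransGen E u v ∧
      ∀ w : V, Relation.ReflTransGen E w u → Relation.ReflTransGen E u w := by
  obtain ⟨u, huv, hmin⟩ := Set.exists_min_image {u | Relation.ReflTransGen E u v}
    (fun u => {w | Relation.ReflTransGen E w u}.ncard) (Set.toFinite _) ⟨v, .refl⟩
  refine ⟨u, huv, fun w hwu => ?_⟩
  have hsub : {x | Relation.ReflTransGen E x w} ⊆ {x | Relation.ReflTransGen E x u} :=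
    fun x hx => Relation.ReflTransGen.trans hx hwu
  have heq := Set.eq_of_subset_of_ncard_le hsub (hmin w (hwu.trans huv)) (Set.toFinite _)
  have hu : u ∈ {x | Relation.ReflTransGen E x u} := Relation.ReflTransGen.refl
  rwa [← heq] at hu

/-- One input node suffices: if `R` intersects the SCC of every root vertex,
then adding a single new vertex `none` with edges to the elements of `R`
makes every original vertex reachable from `none`. -/
theorem single_input_node_suffices
    {V : Type*} [Finite V] (E : V → V → Prop) (R : Set V)
    (hR : ∀ v : V,
      (∀ w : V, Relation.ReflTransGen E w v → Relation.ReflTransGen E v w) →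
      ∃ r ∈ R, Relation.ReflTransGen E v r ∧ Relation.ReflTransGen E r v)
    (E' : Option V → Option V → Prop)
    (hE'1 : ∀ a b : V, E' (some a) (some b) ↔ E a b)
    (hE'2 : ∀ v : V, E' none (some v) ↔ v ∈ R)
    (hE'3 : ∀ a : Option V, ¬ E' a none) :
    ∀ v : V, Relation.ReflTransGen E' none (some v) := by
  intro v
  obtain ⟨u, huv, hu⟩ := exists_root_reflTransGen E v
  obtain ⟨r, hr, -, hru⟩ := hR u hu
  exact .head ((hE'2 r).2 hr) ((hru.trans huv).lift some fun a b h => (hE'1 a b).2 h)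
end
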